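/- For every x in (ZMod p_1) × ⋯ × (ZMod p_k), the map sending n ∈ Fin (p_1 · p_2 ⋯ p_k) to the n-th iterate of T applied to x is a bijection onto (ZMod p_1) × ⋯ × (ZMod p_k); in other words, the finite sequence T^n(x) for n ranging from 0 to p_1⋯p_k − 1 takes all possible values. -/

import Mathlib

/-- Iterating a coordinatewise translation by `u` moves each coordinate by a multiple of `u`. -/
theorem iterate_pi_translation_apply {ι : Type*} {R : ι → Type*} [∀ j, CommRing (R j)]
    (T : (∀ j, R j) → (∀ j, R j)) (u : ∀ j, R j) (hT : ∀ x j, T x j = x j + u j)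
    (n : ℕ) (x : ∀ j, R j) (j : ι) : T^[n] x j = x j + n * u j := by
  induction n with
  | zero => simp
  | succ n ih =>
    rw [Function.iterate_succ_apply', hT, ih]
    push_cast
    ring

/-- Four is a unit modulo every odd number. -/
theorem isUnit_four_zmod_of_odd {n : ℕ} (hn : Odd n) : IsUnit (4 : ZMod n) := by
  have h : Nat.Coprime 4 n := (Nat.coprime_two_left.mpr hn).pow_left 2
  exact_mod_cast (ZMod.isUnit_iff_coprime 4 n).mpr h

/-- For pairwise coprime moduli, a coordinatewise translation by units is a single cycle. -/
theorem bijective_iterate_pi_zmod_translation {ι : Type*} [Fintype ι] (m : ι → ℕ)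
    (hmpos : ∀ j, 0 < m j) (hcop : ∀ i j, i ≠ j → Nat.Coprime (m i) (m j))
    (T : (∀ j, ZMod (m j)) → (∀ j, ZMod (m j))) (u : ∀ j, ZMod (m j))
    (hu : ∀ j, IsUnit (u j)) (hT : ∀ x j, T x j = x j + u j) (x : ∀ j, ZMod (m j)) :
    Function.Bijective (fun n : Fin (∏ j, m j) => T^[(n : ℕ)] x) := by
  classical
  have : ∀ j, NeZero (m j) := fun j => ⟨(hmpos j).ne'⟩
  rw [Fintype.bijective_iff_injective_and_card]
  refine ⟨fun a b hab => ?_, by simp [ZMod.card]⟩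
  have hdvd : ∀ j, (m j : ℤ) ∣ (b : ℕ) - (a : ℕ) := fun j => by
    have h := congrFun hab j
    simp only [iterate_pi_translation_apply T u hT] at h
    have h' := (hu j).mul_right_cancel (add_left_cancel h)
    exact Nat.modEq_iff_dvd.mp ((ZMod.natCast_eq_natCast_iff _ _ _).mp h')
  have hprod : (∏ j, (m j : ℤ)) ∣ (b : ℕ) - (a : ℕ) :=
    Fintype.prod_dvd_of_coprime
      (fun i j hij => Nat.isCoprime_iff_coprime.mpr (hcop i j hij)) hdvd
  have hmod : (a : ℕ) ≡ b [MOD ∏ j, m j] :=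
    Nat.modEq_iff_dvd.mpr (by exact_mod_cast hprod)
  exact Fin.ext (hmod.eq_of_lt_of_lt a.isLt b.isLt)

/-- Let `p₁, …, p_k` be pairwise coprime odd positive integers and `p ≥ 1`.
For the map `T(x)_j = x_j + 4^((2^k − 2^j)·p)` on `(ZMod p₁) × ⋯ × (ZMod p_k)`
and any `x`, the map `n ∈ Fin (p₁ ⋯ p_k) ↦ T^[n] x` is a bijection onto the
product group. -/
theorem T_orbit_bijective (k p : ℕ) (hk : 1 ≤ k) (hp : 1 ≤ p)
    (m : Fin k → ℕ) (hmpos : ∀ j, 0 < m j) (hmodd : ∀ j, Odd (m j))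
    (hcop : ∀ i j, i ≠ j → Nat.Coprime (m i) (m j))
    (T : (∀ j, ZMod (m j)) → (∀ j, ZMod (m j)))
    (hT : ∀ x j, T x j = x j + (4 : ZMod (m j)) ^ ((2 ^ k - 2 ^ ((j : ℕ) + 1)) * p)) :
    ∀ x : ∀ j, ZMod (m j),
      Function.Bijective (fun n : Fin (∏ j, m j) => T^[(n : ℕ)] x) := by
  exact bijective_iterate_pi_zmod_translation m hmpos hcop T _
    (fun j => (isUnit_four_zmod_of_odd (hmodd j)).pow _) hT
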